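/- For coprime positive integers a,b, the sum of the positive integers not representable as nonnegative combinations of a and b equals (a−1)(b−1)(2ab−a−b−1)/12. -/

import Mathlib

open Finset

lemma bs_inj (a b : ℕ) (hab : Nat.Coprime a b) (x y : ℕ) (hx : x < a) (hy : y < a)
    (h : x * b % a = y * b % a) : x = y := by
  have h1 : x * b ≡ y * b [MOD a] := h
  have h2 : x ≡ y [MOD a] := Nat.ModEq.cancel_right_of_coprime hab h1
  exact Nat.ModEq.eq_of_lt_of_lt h2 hx hy

lemma bs_injOn (a b : ℕ) (hab : Nat.Coprime a b) :
    Set.InjOn (fun y => y * b % a) (range a : Set ℕ) := by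
  intro x hx y hy h
  simp only [coe_range, Set.mem_Iio] at hx hy
  exact bs_inj a b hab x y hx hy h

lemma bs_image (a b : ℕ) (ha : 0 < a) (hab : Nat.Coprime a b) :
    (range a).image (fun y => y * b % a) = range a := by
  apply Finset.eq_of_subset_of_card_le
  · intro z hz
    simp only [mem_image, mem_range] at hz ⊢
    obtain ⟨y, _, rfl⟩ := hz
    exact Nat.mod_lt _ ha
  · rw [Finset.card_image_of_injOn (bs_injOn a b hab)]

lemma bs_perm (a b : ℕ) (ha : 0 < a) (hab : Nat.Coprime a b) (f : ℕ → ℚ) :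
    ∑ y ∈ range a, f (y * b % a) = ∑ y ∈ range a, f y := by
  conv_rhs => rw [← bs_image a b ha hab]
  rw [Finset.sum_image (bs_injOn a b hab)]

lemma bs_s1 (n : ℕ) : ∑ y ∈ range n, (y : ℚ) = n * (n - 1) / 2 := by
  induction n with
  | zero => simp
  | succ k ih => rw [sum_range_succ, ih]; push_cast; ring

lemma bs_s2 (n : ℕ) : ∑ y ∈ range n, (y : ℚ) ^ 2 = n * (n - 1) * (2 * n - 1) / 6 := by
  induction n with
  | zero => simp
  | succ k ih => rw [sum_range_succ, ih]; push_cast; ring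

lemma bs_inner (a s : ℕ) (ha : 0 < a) :
    ∑ k ∈ range (s / a), ((s % a + k * a : ℕ) : ℚ) =
      ((s : ℚ) ^ 2 - ((s % a : ℕ) : ℚ) ^ 2) / (2 * a) - ((s : ℚ) - ((s % a : ℕ) : ℚ)) / 2 := by
  have ha' : (a : ℚ) ≠ 0 := by positivity
  have hs : (s : ℚ) = a * ((s / a : ℕ) : ℚ) + ((s % a : ℕ) : ℚ) := by
    exact_mod_cast (Nat.div_add_mod s a).symm
  simp only [Nat.cast_add, Nat.cast_mul]
  rw [sum_add_distrib, ← sum_mul, bs_s1, sum_const, card_range, nsmul_eq_mul]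
  rw [hs]
  generalize ((s / a : ℕ) : ℚ) = q
  generalize ((s % a : ℕ) : ℚ) = r
  field_simp
  ring

/-- Brown–Shiue: for coprime positive `a, b`, the sum of the positive integers not
representable as `xa + yb` equals `(a−1)(b−1)(2ab−a−b−1)/12`. -/
theorem brown_shiue_sum (a b : ℕ) (ha : 0 < a) (hb : 0 < b) (hab : Nat.Coprime a b)
    (NR : Finset ℕ)
    (hNR : ∀ n : ℕ, n ∈ NR ↔ (0 < n ∧ ¬ ∃ x y : ℕ, n = x * a + y * b)) :
    (∑ n ∈ NR, (n : ℚ)) =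
      ((a : ℚ) - 1) * ((b : ℚ) - 1) * (2 * (a : ℚ) * (b : ℚ) - a - b - 1) / 12 := by
  have ha' : (a : ℚ) ≠ 0 := by positivity
  have key : ∑ y ∈ range a, ∑ k ∈ range (y * b / a), ((y * b % a + k * a : ℕ) : ℚ)
      = ∑ n ∈ NR, (n : ℚ) := by
    rw [Finset.sum_sigma' (range a) (fun y => range (y * b / a))
      (fun y k => ((y * b % a + k * a : ℕ) : ℚ))]
    refine Finset.sum_nbij (fun p => p.1 * b % a + p.2 * a) ?_ ?_ ?_ ?_
    · rintro ⟨y, k⟩ h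
      simp only [mem_sigma, mem_range] at h
      obtain ⟨hy, hk⟩ := h
      have hnr : ¬ ∃ x z : ℕ, y * b % a + k * a = x * a + z * b := by
        rintro ⟨x, z, hxz⟩
        have hd := Nat.div_add_mod (y * b) a
        have h1 : y * b ≡ z * b [MOD a] := by
          have h3 : (y * b % a + k * a) % a = (x * a + z * b) % a := by rw [hxz]
          rw [Nat.add_mul_mod_self_right, Nat.mod_mod, Nat.mul_add_mod_self_right] at h3
          exact h3
        have h2 : y ≡ z [MOD a] := Nat.ModEq.cancel_right_of_coprime hab h1
        have h3 : y ≤ z := by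
          have h4 : y % a = z % a := h2
          rw [Nat.mod_eq_of_lt hy] at h4
          rw [h4]; exact Nat.mod_le _ _
        have h4 : y * b ≤ z * b := Nat.mul_le_mul_right b h3
        have h5 : (k + 1) * a ≤ (y * b / a) * a := Nat.mul_le_mul_right a hk
        have h6 : 0 ≤ x * a := Nat.zero_le _
        nlinarith
      rw [hNR]
      refine ⟨?_, hnr⟩
      rcases Nat.eq_zero_or_pos (y * b % a + k * a) with h | h
      · exact absurd ⟨0, 0, by simpa using h⟩ hnr
      · exact h
    · rintro ⟨y, k⟩ h ⟨y', k'⟩ h' e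
      simp only [coe_sigma, Set.mem_sigma_iff, coe_range, Set.mem_Iio] at h h' e
      have h3 := congrArg (· % a) e
      simp only [Nat.add_mul_mod_self_right, Nat.mod_mod] at h3
      obtain rfl := bs_inj a b hab y y' h.1 h'.1 h3
      have h4 : k * a = k' * a := by omega
      obtain rfl := Nat.eq_of_mul_eq_mul_right ha h4
      rfl
    · intro n hn
      obtain ⟨_, hn⟩ := (hNR n).1 hn
      have hm : n % a ∈ (range a).image (fun y => y * b % a) := by
        rw [bs_image a b ha hab]; exact mem_range.2 (Nat.mod_lt _ ha)
      simp only [mem_image, mem_range] at hm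
      obtain ⟨y, hy, hyn⟩ := hm
      have h1 := Nat.div_add_mod n a
      have h2 := Nat.div_add_mod (y * b) a
      refine ⟨⟨y, n / a⟩, ?_, ?_⟩
      · simp only [coe_sigma, Set.mem_sigma_iff, coe_range, Set.mem_Iio]
        refine ⟨hy, ?_⟩
        by_contra hlt
        obtain ⟨c, hc⟩ := Nat.exists_eq_add_of_le (not_lt.1 hlt)
        apply hn
        refine ⟨c, y, ?_⟩
        rw [hc] at h1
        nlinarith
      · simp only
        rw [hyn]; linarith
    · rintro ⟨y, k⟩ _
      rfl
  rw [← key, Finset.sum_congr rfl (fun y _ => bs_inner a (y * b) ha)]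
  rw [sum_sub_distrib, ← sum_div, ← sum_div, sum_sub_distrib, sum_sub_distrib,
    bs_perm a b ha hab (fun r => (r : ℚ) ^ 2), bs_perm a b ha hab (fun r => (r : ℚ))]
  simp only [Nat.cast_mul, mul_pow]
  rw [← sum_mul, ← sum_mul, bs_s1, bs_s2]
  field_simp
  ring
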